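/- For every integer k ≥ 1 there exists a unique r_k > 0 satisfying √(2/π) · e^{−r_k²/2}/r_k = 1/((k+1)(log(k+1))^{3/2}). Moreover there exists K ∈ ℕ such that for all k ≥ K one has (log(k+1))^{1/2} ≤ r_k ≤ 2(log(k+1))^{1/2}. -/

import Mathlib

open Real

theorem strictAntiOn_exp_neg_sq_half_div :
    StrictAntiOn (fun r : ℝ => Real.exp (-r ^ 2 / 2) / r) (Set.Ioi 0) := by
  intro a ha b hb hab
  have ha : 0 < a := ha
  have hexp : Real.exp (-b ^ 2 / 2) < Real.exp (-a ^ 2 / 2) :=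
    Real.exp_lt_exp.2 (by nlinarith)
  exact div_lt_div₀ hexp hab.le (Real.exp_pos _).le ha

theorem exists_exp_neg_sq_half_div_eq {y : ℝ} (hy : 0 < y) :
    ∃ r : ℝ, 0 < r ∧ Real.exp (-r ^ 2 / 2) / r = y := by
  set a := min 1 (Real.exp (-1 / 2) / y) with ha_def
  set b := max 1 (1 / y) with hb_def
  have ha : 0 < a := lt_min one_pos (by positivity)
  have hb : 0 < b := lt_max_of_lt_left one_pos
  have hab : a ≤ b := (min_le_left _ _).trans (le_max_left _ _)
  have hcont : ContinuousOn (fun r : ℝ => Real.exp (-r ^ 2 / 2) / r) (Set.Icc a b) :=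
    ContinuousOn.div (by fun_prop) continuousOn_id fun x hx => (ha.trans_le hx.1).ne'
  have hfa : y ≤ Real.exp (-a ^ 2 / 2) / a := by
    have h1 : a ≤ 1 := min_le_left _ _
    have h2 : a * y ≤ Real.exp (-1 / 2) := (le_div_iff₀ hy).1 (min_le_right _ _)
    have h3 : Real.exp (-1 / 2) ≤ Real.exp (-a ^ 2 / 2) := Real.exp_le_exp.2 (by nlinarith)
    rw [le_div_iff₀ ha]
    linarith
  have hfb : Real.exp (-b ^ 2 / 2) / b ≤ y := by
    have h1 : 1 ≤ b * y := (div_le_iff₀ hy).1 (le_max_right _ _)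
    have h2 : Real.exp (-b ^ 2 / 2) ≤ 1 := Real.exp_le_one_iff.2 (by nlinarith)
    rw [div_le_iff₀ hb]
    linarith
  obtain ⟨r, hr, hry⟩ := intermediate_value_Icc' hab hcont ⟨hfb, hfa⟩
  exact ⟨r, ha.trans_le hr.1, hry⟩

theorem half_le_sqrt_two_div_pi : 1 / 2 ≤ Real.sqrt (2 / π) := by
  apply Real.le_sqrt_of_sq_le
  rw [le_div_iff₀ Real.pi_pos]
  linarith [Real.pi_lt_four]

theorem sqrt_two_div_pi_le_one : Real.sqrt (2 / π) ≤ 1 := by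
  rw [Real.sqrt_le_one, div_le_one Real.pi_pos]
  exact Real.two_le_pi

theorem rpow_three_halves {x : ℝ} (hx : 0 < x) : x ^ ((3 : ℝ) / 2) = x * Real.sqrt x := by
  rw [Real.sqrt_eq_rpow, show (3 : ℝ) / 2 = 1 + 1 / 2 by norm_num, Real.rpow_add hx,
    Real.rpow_one]

/-- If `√(2/π) · e^{−r²/2}/r = e^{−L} L^{−3/2}` with `L ≥ 2`, then `√L ≤ r ≤ 2√L`. -/
theorem sqrt_le_and_le_two_mul_sqrt {L r : ℝ} (hL : 2 ≤ L) (hr : 0 < r)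
    (h : Real.sqrt (2 / π) * (Real.exp (-r ^ 2 / 2) / r) = 1 / (Real.exp L * (L * Real.sqrt L))) :
    Real.sqrt L ≤ r ∧ r ≤ 2 * Real.sqrt L := by
  have hL0 : 0 < L := by linarith
  have hs : 0 < Real.sqrt L := Real.sqrt_pos.2 hL0
  have hsq : Real.sqrt L ^ 2 = L := Real.sq_sqrt hL0.le
  have hc := half_le_sqrt_two_div_pi
  have hc1 := sqrt_two_div_pi_le_one
  have hc0 : 0 < Real.sqrt (2 / π) := by linarith
  constructor
  · by_contra! hlt
    have h1 := mul_lt_mul_of_pos_left (strictAntiOn_exp_neg_sq_half_div hr hs hlt) hc0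
    simp only [h, hsq] at h1
    refine h1.not_ge ?_
    have h2 : Real.exp L = Real.exp (L / 2) * Real.exp (L / 2) := by
      rw [← Real.exp_add, add_halves]
    have h3 : 1 ≤ Real.exp (L / 2) := Real.one_le_exp (by linarith)
    rw [neg_div, Real.exp_neg, h2, div_le_iff₀ (by positivity)]
    have h4 : Real.sqrt (2 / π) * ((Real.exp (L / 2))⁻¹ / Real.sqrt L) *
        (Real.exp (L / 2) * Real.exp (L / 2) * (L * Real.sqrt L)) =
        Real.sqrt (2 / π) * L * Real.exp (L / 2) := by
      field_simp
    rw [h4]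
    have h5 : 1 ≤ Real.sqrt (2 / π) * L := by nlinarith
    exact one_le_mul_of_one_le_of_one_le h5 h3
  · by_contra! hlt
    have h1 := mul_lt_mul_of_pos_left
      (strictAntiOn_exp_neg_sq_half_div (Set.mem_Ioi.2 (by positivity)) hr hlt) hc0
    simp only [h] at h1
    refine h1.not_ge ?_
    have h2 : -(2 * Real.sqrt L) ^ 2 / 2 = -(L + L) := by rw [mul_pow, hsq]; ring
    rw [h2, Real.exp_neg, Real.exp_add, le_div_iff₀ (by positivity)]
    have h4 : Real.sqrt (2 / π) * ((Real.exp L * Real.exp L)⁻¹ / (2 * Real.sqrt L)) *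
        (Real.exp L * (L * Real.sqrt L)) = Real.sqrt (2 / π) * L / 2 / Real.exp L := by
      field_simp
    rw [h4, div_le_one (Real.exp_pos _)]
    nlinarith [Real.add_one_le_exp L]

/-- For every integer `k ≥ 1` there exists a unique `r_k > 0` with
`√(2/π) · e^{−r_k²/2}/r_k = 1/((k+1)(log(k+1))^{3/2})`; moreover there is `K ∈ ℕ` such
that `(log(k+1))^{1/2} ≤ r_k ≤ 2(log(k+1))^{1/2}` for all `k ≥ K`. -/
theorem exists_unique_rk_and_growth :
    (∀ k : ℕ, 1 ≤ k → ∃! r : ℝ, 0 < r ∧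
      Real.sqrt (2 / π) * (Real.exp (-r ^ 2 / 2) / r) =
        1 / (((k : ℝ) + 1) * Real.log ((k : ℝ) + 1) ^ ((3 : ℝ) / 2))) ∧
    ∀ r : ℕ → ℝ,
      (∀ k : ℕ, 1 ≤ k → 0 < r k ∧
        Real.sqrt (2 / π) * (Real.exp (-(r k) ^ 2 / 2) / r k) =
          1 / (((k : ℝ) + 1) * Real.log ((k : ℝ) + 1) ^ ((3 : ℝ) / 2))) →
      ∃ K : ℕ, ∀ k : ℕ, K ≤ k → 1 ≤ k →
        Real.sqrt (Real.log ((k : ℝ) + 1)) ≤ r k ∧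
        r k ≤ 2 * Real.sqrt (Real.log ((k : ℝ) + 1)) := by
  constructor
  · intro k hk
    have hk1 : (1 : ℝ) ≤ k := by exact_mod_cast hk
    have hlog : 0 < Real.log ((k : ℝ) + 1) := Real.log_pos (by linarith)
    have hc : 0 < Real.sqrt (2 / π) := by positivity
    obtain ⟨r, hr, hry⟩ := exists_exp_neg_sq_half_div_eq
      (y := 1 / (((k : ℝ) + 1) * Real.log ((k : ℝ) + 1) ^ ((3 : ℝ) / 2)) / Real.sqrt (2 / π))
      (by positivity)
    refine ⟨r, ⟨hr, by rw [hry, mul_div_cancel₀ _ hc.ne']⟩, ?_⟩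
    rintro s ⟨hs, hsy⟩
    refine strictAntiOn_exp_neg_sq_half_div.injOn hs hr ?_
    simp only [hry, ← hsy, mul_div_cancel_left₀ _ hc.ne']
  · intro r hr
    refine ⟨⌈Real.exp 2⌉₊, fun k hK hk => ?_⟩
    have hk0 : (0 : ℝ) < (k : ℝ) + 1 := by positivity
    have hL : 2 ≤ Real.log ((k : ℝ) + 1) := by
      rw [Real.le_log_iff_exp_le hk0]
      linarith [Nat.ceil_le.1 hK]
    obtain ⟨hpos, heq⟩ := hr k hk
    refine sqrt_le_and_le_two_mul_sqrt hL hpos ?_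
    rw [heq, rpow_three_halves (by linarith), Real.exp_log hk0]
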